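/- If D and H are Bott equivalent acyclic digraphs, then for every pair of natural numbers i and k, the number of sibling groups of D having exactly k vertices that are contained in L_i(D) equals the number of sibling groups of H having exactly k vertices that are contained in L_i(H). -/

import Mathlib

/-!
Digraphs on a finite vertex set `V` are modelled as irreflexive relations,
encoded as functions `V → V → Bool`.
-/

variable {V : Type*} [Fintype V] [DecidableEq V]

/-- The in-neighborhood `N⁻_D(v)` of a vertex `v`. -/
def inN (D : V → V → Bool) (v : V) : Finset V :=
  Finset.univ.filter fun u => D u v = true

/-- The out-neighborhood `N⁺_D(v)` of a vertex `v`. -/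
def outN (D : V → V → Bool) (v : V) : Finset V :=
  Finset.univ.filter fun w => D v w = true

/-- The out-degree `deg⁺_D(v)` of a vertex `v`. -/
def outDeg (D : V → V → Bool) (v : V) : ℕ := (outN D v).card

/-- Local complementation `D*v`: for each pair `(u,w) ∈ N⁻_D(v) × N⁺_D(v)` with
`u ≠ w`, the arc `(u,w)` is toggled. -/
def localComp (D : V → V → Bool) (v : V) : V → V → Bool :=
  fun u w => if u ≠ w ∧ D u v = true ∧ D v w = true then !(D u w) else D u w

/-- The slide `D Δ vw`: the out-neighborhood of `w` is replaced by the symmetric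
difference `N⁺_D(w) Δ N⁺_D(v)`; all other arcs are unchanged. -/
def slide (D : V → V → Bool) (v w : V) : V → V → Bool :=
  fun a b => if a = w then xor (D w b) (D v b) else D a b

/-- A digraph is acyclic if it has no directed cycle, i.e. its transitive
closure is irreflexive. -/
def IsAcyclic (D : V → V → Bool) : Prop :=
  ∀ v, ¬ Relation.TransGen (fun a b => D a b = true) v v

/-- There is a directed walk (in an acyclic digraph: a directed path) with
exactly `k` arcs ending at `v`. -/
def pathEndB (D : V → V → Bool) : ℕ → V → Bool
  | 0, _ => true
  | k+1, v => decide (∃ u, D u v = true ∧ pathEndB D k u = true)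

/-- The `k`-th level `L_k(D)`: the set of vertices `v` such that a longest
directed path ending at `v` has exactly `k` arcs. -/
def level (D : V → V → Bool) (k : ℕ) : Finset V :=
  Finset.univ.filter fun v => pathEndB D k v = true ∧ pathEndB D (k+1) v = false

/-- One step of Bott equivalence on digraphs: a local complementation,
a slide, or a digraph isomorphism. -/
def BottStep (D H : V → V → Bool) : Prop :=
  (∃ v, H = localComp D v) ∨
  (∃ v w, v ≠ w ∧ inN D v = inN D w ∧ H = slide D v w) ∨
  (∃ e : Equiv.Perm V, ∀ a b, H a b = D (e a) (e b))

/-- Two digraphs are Bott equivalent if one is obtained from the other by a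
finite sequence of local complementations, slides and isomorphisms. -/
def BottEquiv (D H : V → V → Bool) : Prop :=
  Relation.ReflTransGen BottStep D H

/-- The adjacency matrix of a digraph, over `𝔽₂ = ZMod 2`. -/
def adjMat (D : V → V → Bool) : Matrix V V (ZMod 2) :=
  fun i j => if D i j = true then 1 else 0

/-- The sibling group of a vertex `v`: the set of vertices having the same set
of in-neighbors as `v`. -/
def siblingGroup (D : V → V → Bool) (v : V) : Finset V :=
  Finset.univ.filter fun y => inN D y = inN D v

set_option linter.unusedSectionVars false

theorem mem_inN_iff {D : V → V → Bool} {u v : V} : u ∈ inN D v ↔ D u v = true := by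
  simp [inN]

theorem inN_eq_iff {D : V → V → Bool} {v w : V} :
    inN D v = inN D w ↔ ∀ u, D u v = D u w := by
  simp only [Finset.ext_iff, mem_inN_iff, ← Bool.eq_iff_iff]

theorem pathEndB_succ_iff {D : V → V → Bool} {k : ℕ} {v : V} :
    pathEndB D (k + 1) v = true ↔ ∃ u, D u v = true ∧ pathEndB D k u = true := by
  simp [pathEndB]

theorem pathEndB_of_succ {D : V → V → Bool} {k : ℕ} {v : V}
    (h : pathEndB D (k + 1) v = true) : pathEndB D k v = true := by
  induction k generalizing v with
  | zero => rfl
  | succ k ih =>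
    obtain ⟨u, huv, hu⟩ := pathEndB_succ_iff.1 h
    exact pathEndB_succ_iff.2 ⟨u, huv, ih hu⟩

theorem pathEndB_of_le {D : V → V → Bool} {k l : ℕ} (hkl : k ≤ l) {v : V}
    (h : pathEndB D l v = true) : pathEndB D k v = true := by
  induction hkl with
  | refl => exact h
  | step _ ih => exact ih (pathEndB_of_succ h)

theorem pathEndB_eq_of_inN_eq {D : V → V → Bool} {v w : V} (h : inN D v = inN D w) (k : ℕ) :
    pathEndB D k v = pathEndB D k w := by
  cases k with
  | zero => rfl
  | succ k =>
    rw [Bool.eq_iff_iff, pathEndB_succ_iff, pathEndB_succ_iff]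
    simp only [inN_eq_iff.1 h]

/-- If every arc of `H` raises the length of walks of `D`, then walks of `H` are no longer than
walks of `D`. -/
theorem pathEndB_mono {D H : V → V → Bool}
    (h : ∀ a b, H a b = true → ∀ k, pathEndB D k a = true → pathEndB D (k + 1) b = true)
    {k : ℕ} {v : V} (hv : pathEndB H k v = true) : pathEndB D k v = true := by
  induction k generalizing v with
  | zero => rfl
  | succ k ih =>
    obtain ⟨u, huv, hu⟩ := pathEndB_succ_iff.1 hv
    exact h u v huv k (ih hu)

/-- Directed walks ending at any given vertex have bounded length. -/
def HasBoundedWalks (D : V → V → Bool) : Prop :=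
  ∀ v, ∃ k, pathEndB D k v = false

theorem IsAcyclic.hasBoundedWalks {D : V → V → Bool} (hD : IsAcyclic D) :
    HasBoundedWalks D := by
  have : Std.Irrefl (Relation.TransGen fun a b => D a b = true) := ⟨hD⟩
  have hwf := Finite.wellFounded_of_trans_of_irrefl (Relation.TransGen fun a b => D a b = true)
  intro v
  induction v using hwf.induction with
  | _ v ih =>
    have hbound : ∀ u, ∃ k, D u v = true → pathEndB D k u = false := by
      intro u
      by_cases huv : D u v = true
      · obtain ⟨k, hk⟩ := ih u (.single huv)
        exact ⟨k, fun _ => hk⟩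
      · exact ⟨0, fun h => absurd h huv⟩
    choose f hf using hbound
    refine ⟨Finset.univ.sup f + 1, ?_⟩
    rw [← Bool.not_eq_true, pathEndB_succ_iff]
    rintro ⟨u, huv, hu⟩
    have := pathEndB_of_le (Finset.le_sup (f := f) (Finset.mem_univ u)) hu
    simp [hf u huv] at this

theorem HasBoundedWalks.asymm {D : V → V → Bool} (hD : HasBoundedWalks D) {u v : V}
    (huv : D u v = true) : D v u = false := by
  by_contra hvu
  rw [Bool.not_eq_false] at hvu
  have hall : ∀ k, pathEndB D k u = true ∧ pathEndB D k v = true := by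
    intro k
    induction k with
    | zero => exact ⟨rfl, rfl⟩
    | succ k ih =>
      exact ⟨pathEndB_succ_iff.2 ⟨v, hvu, ih.2⟩, pathEndB_succ_iff.2 ⟨u, huv, ih.1⟩⟩
  obtain ⟨k, hk⟩ := hD u
  simp [(hall k).1] at hk

theorem HasBoundedWalks.irrefl {D : V → V → Bool} (hD : HasBoundedWalks D) (v : V) :
    D v v = false := by
  by_contra h
  rw [Bool.not_eq_false] at h
  simp [hD.asymm h] at h

theorem HasBoundedWalks.localComp_apply {D : V → V → Bool} (hD : HasBoundedWalks D)
    (v u w : V) : localComp D v u w = xor (D u w) (D u v && D v w) := by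
  unfold localComp
  have hne : D u v = true → D v w = true → u ≠ w := by
    rintro huv hvw rfl
    simp [hD.asymm huv] at hvw
  cases huv : D u v <;> cases hvw : D v w <;> simp_all

theorem localComp_raises_pathEndB (D : V → V → Bool) (v a b : V)
    (hab : localComp D v a b = true) (k : ℕ) (ha : pathEndB D k a = true) :
    pathEndB D (k + 1) b = true := by
  unfold localComp at hab
  split_ifs at hab with h
  · exact pathEndB_of_succ (pathEndB_succ_iff.2 ⟨v, h.2.2, pathEndB_succ_iff.2 ⟨a, h.2.1, ha⟩⟩)
  · exact pathEndB_succ_iff.2 ⟨a, hab, ha⟩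

theorem slide_raises_pathEndB {D : V → V → Bool} {v w : V} (hvw : inN D v = inN D w)
    (a b : V) (hab : slide D v w a b = true) (k : ℕ) (ha : pathEndB D k a = true) :
    pathEndB D (k + 1) b = true := by
  unfold slide at hab
  split_ifs at hab with h
  · subst h
    cases hab' : D a b
    · have hvb : D v b = true := by simpa [hab'] using hab
      exact pathEndB_succ_iff.2 ⟨v, hvb, (pathEndB_eq_of_inN_eq hvw k).trans ha⟩
    · exact pathEndB_succ_iff.2 ⟨a, hab', ha⟩
  · exact pathEndB_succ_iff.2 ⟨a, hab, ha⟩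

theorem HasBoundedWalks.of_pathEndB_imp {D H : V → V → Bool} (hD : HasBoundedWalks D)
    (h : ∀ k v, pathEndB H k v = true → pathEndB D k v = true) : HasBoundedWalks H := by
  intro v
  obtain ⟨k, hk⟩ := hD v
  refine ⟨k, ?_⟩
  rw [← Bool.not_eq_true] at hk ⊢
  exact fun hv => hk (h k v hv)

theorem HasBoundedWalks.localComp {D : V → V → Bool} (hD : HasBoundedWalks D) (v : V) :
    HasBoundedWalks (localComp D v) :=
  hD.of_pathEndB_imp fun _ _ => pathEndB_mono (localComp_raises_pathEndB D v)

theorem HasBoundedWalks.localComp_localComp {D : V → V → Bool} (hD : HasBoundedWalks D) (v : V) :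
    _root_.localComp (_root_.localComp D v) v = D := by
  funext a b
  simp [(hD.localComp v).localComp_apply, hD.localComp_apply, hD.irrefl v]

theorem HasBoundedWalks.pathEndB_localComp {D : V → V → Bool} (hD : HasBoundedWalks D)
    (v : V) (k : ℕ) (x : V) : pathEndB (_root_.localComp D v) k x = pathEndB D k x := by
  rw [Bool.eq_iff_iff]
  refine ⟨pathEndB_mono (localComp_raises_pathEndB D v), fun h => ?_⟩
  rw [← hD.localComp_localComp v] at h
  exact pathEndB_mono (localComp_raises_pathEndB _ v) h

theorem HasBoundedWalks.inN_localComp_eq_iff {D : V → V → Bool} (hD : HasBoundedWalks D)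
    (v x y : V) :
    inN (_root_.localComp D v) x = inN (_root_.localComp D v) y ↔ inN D x = inN D y := by
  simp only [inN_eq_iff, hD.localComp_apply]
  refine ⟨fun h u => ?_, fun h u => by rw [h u, h v]⟩
  have hv := h v
  simp only [hD.irrefl v, Bool.false_and, Bool.xor_false] at hv
  simpa [hv] using h u

theorem inN_slide_eq_iff (D : V → V → Bool) {v w : V} (hne : v ≠ w) (x y : V) :
    inN (slide D v w) x = inN (slide D v w) y ↔ inN D x = inN D y := by
  simp only [inN_eq_iff, slide]
  refine ⟨fun h u => ?_, fun h u => by rw [h u, h v, h w]⟩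
  have hv := h v
  have hu := h u
  simp only [if_neg hne] at hv
  split_ifs at hu with huw
  · subst huw
    simpa [hv] using hu
  · exact hu

theorem slide_slide (D : V → V → Bool) {v w : V} (hne : v ≠ w) :
    slide (slide D v w) v w = D := by
  funext a b
  by_cases h : a = w <;> simp [slide, h, hne]

theorem pathEndB_slide {D : V → V → Bool} {v w : V} (hne : v ≠ w) (hvw : inN D v = inN D w)
    (k : ℕ) (x : V) : pathEndB (slide D v w) k x = pathEndB D k x := by
  rw [Bool.eq_iff_iff]
  refine ⟨pathEndB_mono (slide_raises_pathEndB hvw), fun h => ?_⟩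
  rw [← slide_slide D hne] at h
  exact pathEndB_mono (slide_raises_pathEndB ((inN_slide_eq_iff D hne v w).2 hvw)) h

theorem pathEndB_perm {D H : V → V → Bool} (e : Equiv.Perm V)
    (h : ∀ a b, H a b = D (e a) (e b)) (k : ℕ) (x : V) :
    pathEndB H k x = pathEndB D k (e x) := by
  induction k generalizing x with
  | zero => rfl
  | succ k ih =>
    rw [Bool.eq_iff_iff, pathEndB_succ_iff, pathEndB_succ_iff]
    simp only [h, ih]
    exact e.exists_congr_left.trans (by simp)

/-- A permutation preserving lengths of walks and the sibling relation, but not necessarily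
the arcs. -/
def PreservesLevelsAndSiblings (D H : V → V → Bool) (e : Equiv.Perm V) : Prop :=
  (∀ k x, pathEndB H k x = pathEndB D k (e x)) ∧
    ∀ x y, inN H x = inN H y ↔ inN D (e x) = inN D (e y)

theorem BottStep.exists_preservesLevelsAndSiblings {D H : V → V → Bool} (h : BottStep D H)
    (hD : HasBoundedWalks D) : ∃ e, PreservesLevelsAndSiblings D H e := by
  rcases h with ⟨v, rfl⟩ | ⟨v, w, hne, hvw, rfl⟩ | ⟨e, he⟩
  · exact ⟨1, hD.pathEndB_localComp v, hD.inN_localComp_eq_iff v⟩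
  · exact ⟨1, pathEndB_slide hne hvw, inN_slide_eq_iff D hne⟩
  · refine ⟨e, pathEndB_perm e he, fun x y => ?_⟩
    simp only [inN_eq_iff, he]
    exact e.forall_congr_left.trans (by simp)

theorem PreservesLevelsAndSiblings.hasBoundedWalks {D H : V → V → Bool} {e : Equiv.Perm V}
    (h : PreservesLevelsAndSiblings D H e) (hD : HasBoundedWalks D) : HasBoundedWalks H := by
  intro v
  obtain ⟨k, hk⟩ := hD (e v)
  exact ⟨k, (h.1 k v).trans hk⟩

theorem PreservesLevelsAndSiblings.trans {D H K : V → V → Bool} {e f : Equiv.Perm V}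
    (h : PreservesLevelsAndSiblings D H e) (h' : PreservesLevelsAndSiblings H K f) :
    PreservesLevelsAndSiblings D K (f.trans e) :=
  ⟨fun k x => (h'.1 k x).trans (h.1 k (f x)), fun x y => (h'.2 x y).trans (h.2 (f x) (f y))⟩

theorem BottEquiv.exists_preservesLevelsAndSiblings {D H : V → V → Bool} (h : BottEquiv D H)
    (hD : HasBoundedWalks D) : ∃ e, PreservesLevelsAndSiblings D H e := by
  induction h with
  | refl => exact ⟨1, fun _ _ => rfl, fun _ _ => Iff.rfl⟩
  | tail _ hstep ih =>
    obtain ⟨e, he⟩ := ih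
    obtain ⟨f, hf⟩ := hstep.exists_preservesLevelsAndSiblings (he.hasBoundedWalks hD)
    exact ⟨f.trans e, he.trans hf⟩

theorem PreservesLevelsAndSiblings.siblingGroup_apply {D H : V → V → Bool} {e : Equiv.Perm V}
    (h : PreservesLevelsAndSiblings D H e) (v : V) :
    siblingGroup D (e v) = (siblingGroup H v).map e.toEmbedding := by
  ext y
  obtain ⟨x, rfl⟩ := e.surjective y
  simp [siblingGroup, h.2]

theorem PreservesLevelsAndSiblings.level_eq_map {D H : V → V → Bool} {e : Equiv.Perm V}
    (h : PreservesLevelsAndSiblings D H e) (i : ℕ) :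
    level D i = (level H i).map e.toEmbedding := by
  ext y
  obtain ⟨x, rfl⟩ := e.surjective y
  simp [level, h.1]

/-- If `D` and `H` are Bott equivalent acyclic digraphs, then for
every pair `i`, `k`, the number of sibling groups of `D` with exactly `k`
vertices contained in `L_i(D)` equals the number of sibling groups of `H` with
exactly `k` vertices contained in `L_i(H)`. -/
theorem siblingGroups_bottEquiv (D H : V → V → Bool)
    (hD : IsAcyclic D) (hH : IsAcyclic H) (hBE : BottEquiv D H) (i k : ℕ) :
    Set.ncard {S : Finset V | (∃ v, S = siblingGroup D v) ∧
        S ⊆ level D i ∧ S.card = k} =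
      Set.ncard {S : Finset V | (∃ v, S = siblingGroup H v) ∧
        S ⊆ level H i ∧ S.card = k} := by
  obtain ⟨e, he⟩ := hBE.exists_preservesLevelsAndSiblings hD.hasBoundedWalks
  symm
  rw [← Set.ncard_image_of_injective _ (Finset.map_injective e.toEmbedding)]
  congr 1
  ext S
  simp only [Set.mem_ofPred_eq, Set.mem_image]
  constructor
  · rintro ⟨_, ⟨⟨v, rfl⟩, hS, hk⟩, rfl⟩
    refine ⟨⟨e v, (he.siblingGroup_apply v).symm⟩, ?_, by simpa using hk⟩
    rwa [he.level_eq_map, Finset.map_subset_map]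
  · rintro ⟨⟨v, rfl⟩, hS, hk⟩
    obtain ⟨v, rfl⟩ := e.surjective v
    rw [he.siblingGroup_apply] at hS hk ⊢
    rw [he.level_eq_map, Finset.map_subset_map] at hS
    exact ⟨_, ⟨⟨v, rfl⟩, hS, by simpa using hk⟩, rfl⟩
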